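/- Let (Ω, μ) be a σ-finite measure space, let p ∈ [1, ∞), and let (T_t)_{t ∈ [0,∞)} be a positive and contractive C₀-semigroup on L^p(Ω, μ; ℝ). Assume there exists f₀ ∈ L^p with T_t f₀ = f₀ for all t ≥ 0 and f₀(x) > 0 for μ-almost every x ∈ Ω, and assume that T_{t₀} is an integral operator for at least one time t₀ ≥ 0. Then for every f ∈ L^p the limit g := lim_{t→∞} T_t f exists in the norm of L^p, and the limit g satisfies T_s g = g for all s ≥ 0. -/

import Mathlib

open MeasureTheory Filter
open scoped ENNReal NNReal

noncomputable section

/-- A bounded linear operator on `L^p` is positive if it maps a.e.-nonnegative functions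
to a.e.-nonnegative functions. -/
def IsPositiveOp {Ω : Type*} [MeasurableSpace Ω] {μ : Measure Ω} {p : ℝ≥0∞} [Fact (1 ≤ p)]
    (T : Lp ℝ p μ →L[ℝ] Lp ℝ p μ) : Prop :=
  ∀ f : Lp ℝ p μ, 0 ≤ f → 0 ≤ T f

/-- A bounded linear operator on `L^p` is an integral operator if there is a
nonnegative measurable kernel `k : Ω × Ω → [0,∞)` such that for every `f ∈ L^p` the
function `x ↦ k x y * f x` is integrable for a.e. `y` and
`(T f)(y) = ∫ k x y * f x dμ(x)` for a.e. `y`. -/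
def IsIntegralOp {Ω : Type*} [MeasurableSpace Ω] {μ : Measure Ω} {p : ℝ≥0∞} [Fact (1 ≤ p)]
    (T : Lp ℝ p μ →L[ℝ] Lp ℝ p μ) : Prop :=
  ∃ k : Ω → Ω → ℝ, Measurable (Function.uncurry k) ∧ (∀ x y, 0 ≤ k x y) ∧
    ∀ f : Lp ℝ p μ,
      (∀ᵐ y ∂μ, Integrable (fun x => k x y * f x) μ) ∧
      (T f : Ω → ℝ) =ᵐ[μ] fun y => ∫ x, k x y * f x ∂μ

open Topology InnerProductSpace

theorem exists_subseq_forall_tendsto_inner {H : Type*} [NormedAddCommGroup H]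
    [InnerProductSpace ℝ H] [CompleteSpace H] (a : ℕ → H) (C : ℝ) (ha : ∀ n, ‖a n‖ ≤ C) :
    ∃ φ : ℕ → ℕ, StrictMono φ ∧
      ∀ z : H, ∃ l : ℝ, Tendsto (fun n => ⟪a (φ n), z⟫_ℝ) atTop (𝓝 l) := by
  set K : Submodule ℝ H := (Submodule.span ℝ (Set.range a)).topologicalClosure with hK
  have haK : ∀ n, a n ∈ K := fun n =>
    Submodule.le_topologicalClosure _ (Submodule.subset_span ⟨n, rfl⟩)
  have hsep : TopologicalSpace.IsSeparable (K : Set H) := by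
    rw [hK, Submodule.topologicalClosure_coe]
    exact ((Set.countable_range a).isSeparable.span (R := ℝ)).closure
  have : TopologicalSpace.SeparableSpace K := hsep.separableSpace
  let F : ℕ → WeakDual ℝ K := fun n =>
    StrongDual.toWeakDual ((innerSL ℝ (a n)).comp K.subtypeL)
  have hF : ∀ n, F n ∈ WeakDual.toStrongDual ⁻¹' Metric.closedBall (0 : StrongDual ℝ K) C := by
    intro n
    have hC : 0 ≤ C := (norm_nonneg _).trans (ha n)
    refine mem_closedBall_zero_iff (E := StrongDual ℝ K).2 ?_
    refine ContinuousLinearMap.opNorm_le_bound _ hC fun z => ?_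
    calc ‖⟪a n, (z : H)⟫_ℝ‖ ≤ ‖a n‖ * ‖(z : H)‖ := norm_inner_le_norm _ _
      _ ≤ C * ‖z‖ := by gcongr; exacts [ha n, le_rfl]
  obtain ⟨f, -, φ, hφ, hlim⟩ := WeakDual.isSeqCompact_closedBall ℝ K 0 C hF
  refine ⟨φ, hφ, fun z => ⟨f (K.orthogonalProjectionOnto z), ?_⟩⟩
  have h := ((WeakDual.eval_continuous (K.orthogonalProjectionOnto z)).tendsto f).comp hlim
  refine h.congr fun n => ?_
  change ⟪a (φ n), (K.orthogonalProjectionOnto z : H)⟫_ℝ = _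
  exact K.inner_orthogonalProjectionOnto_eq_of_mem_left ⟨a (φ n), haK _⟩ z

section LpLemmas

variable {Ω : Type*} [MeasurableSpace Ω] {μ : Measure Ω}

theorem exists_subseq_forall_cauchySeq_integral_mul [SigmaFinite μ] (s : ℕ → Ω → ℝ)
    (hs : ∀ n, AEStronglyMeasurable (s n) μ) (hs1 : ∀ n, ∀ᵐ x ∂μ, |s n x| ≤ 1) :
    ∃ φ : ℕ → ℕ, StrictMono φ ∧
      ∀ κ : Ω → ℝ, Integrable κ μ → CauchySeq fun n => ∫ x, κ x * s (φ n) x ∂μ := by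
  obtain ⟨g, hgpos, hgm, hg⟩ := exists_pos_lintegral_lt_of_sigmaFinite μ one_ne_zero
  set w : Ω → ℝ := fun x => Real.sqrt (g x) with hw
  have hwpos : ∀ x, 0 < w x := fun x => Real.sqrt_pos.2 (by exact_mod_cast hgpos x)
  have hwm : Measurable w := by fun_prop
  have hw2 : ∀ x, w x ^ 2 = g x := fun x => Real.sq_sqrt (by positivity)
  have hwL : MemLp w 2 μ := by
    rw [memLp_two_iff_integrable_sq hwm.aestronglyMeasurable]
    simp_rw [hw2]
    refine ⟨hgm.coe_nnreal_real.aestronglyMeasurable, ?_⟩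
    rw [hasFiniteIntegral_iff_enorm]
    simpa using hg.trans ENNReal.one_lt_top
  have haL : ∀ n, MemLp (fun x => s n x * w x) 2 μ := fun n =>
    hwL.mono ((hs n).mul hwm.aestronglyMeasurable) <| by
      filter_upwards [hs1 n] with x hx
      rw [norm_mul]
      exact mul_le_of_le_one_left (norm_nonneg _) hx
  have hab : ∀ n, ‖(haL n).toLp _‖ ≤ ‖hwL.toLp _‖ := fun n =>
    Lp.norm_le_norm_of_ae_le <| by
      filter_upwards [hs1 n, (haL n).coeFn_toLp, hwL.coeFn_toLp] with x hx h1 h2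
      rw [h1, h2, norm_mul]
      exact mul_le_of_le_one_left (norm_nonneg _) hx
  obtain ⟨φ, hφ, hlim⟩ := exists_subseq_forall_tendsto_inner (fun n => (haL n).toLp _) _ hab
  refine ⟨φ, hφ, fun κ hκ => ?_⟩
  set A : ℕ → Set Ω := fun M => {x | |hκ.1.mk κ x| ≤ M * w x ^ 2} with hA
  have hκm : Measurable (hκ.1.mk κ) := hκ.1.measurable_mk
  have hAm : ∀ M, MeasurableSet (A M) := fun M =>
    measurableSet_le (by fun_prop) (by fun_prop)
  have hzL : ∀ M : ℕ, MemLp ((A M).indicator fun x => hκ.1.mk κ x / w x) 2 μ := by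
    intro M
    refine (hwL.const_mul (M : ℝ)).mono
      ((hκm.div hwm).indicator (hAm M)).aestronglyMeasurable (.of_forall fun x => ?_)
    by_cases hx : x ∈ A M
    · rw [Set.indicator_of_mem hx, norm_div, norm_mul, div_le_iff₀ (by simpa using (hwpos x).ne')]
      have : |hκ.1.mk κ x| ≤ M * w x ^ 2 := hx
      simp only [Real.norm_eq_abs, abs_of_pos (hwpos x), Nat.abs_cast]
      linarith
    · rw [Set.indicator_of_notMem hx, norm_zero]; exact norm_nonneg _
  have hcau : ∀ M, CauchySeq fun n => ∫ x, (A M).indicator κ x * s (φ n) x ∂μ := by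
    intro M
    obtain ⟨l, hl⟩ := hlim ((hzL M).toLp _)
    refine (hl.congr fun n => ?_).cauchySeq
    rw [L2.inner_def]
    refine integral_congr_ae ?_
    filter_upwards [(haL (φ n)).coeFn_toLp, (hzL M).coeFn_toLp, hκ.1.ae_eq_mk] with x h1 h2 h3
    rw [h1, h2]
    by_cases hx : x ∈ A M
    · have := (hwpos x).ne'
      simp only [Set.indicator_of_mem hx, h3, RCLike.inner_apply, conj_trivial]
      field_simp
    · simp [Set.indicator_of_notMem hx]
  have hint : ∀ (κ' : Ω → ℝ), Integrable κ' μ → ∀ n, Integrable (fun x => κ' x * s n x) μ :=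
    fun κ' h n => h.mul_bdd (hs n) (hs1 n)
  have hκA : ∀ M, Integrable ((A M).indicator κ) μ := fun M => hκ.indicator (hAm M)
  have herr : Tendsto (fun M : ℕ => ∫ x, |κ x - (A M).indicator κ x| ∂μ) atTop (𝓝 0) := by
    have : Tendsto (fun M : ℕ => ∫ x, |κ x - (A M).indicator κ x| ∂μ) atTop
        (𝓝 (∫ x, (0 : ℝ) ∂μ)) := by
      refine tendsto_integral_of_dominated_convergence (fun x => |κ x|)
        (fun M => (hκ.sub (hκA M)).abs.1) hκ.abs (fun M => .of_forall fun x => ?_)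
        (.of_forall fun x => ?_)
      · by_cases hx : x ∈ A M <;> simp [hx]
      · obtain ⟨M, hM⟩ := exists_nat_ge (|hκ.1.mk κ x| / w x ^ 2)
        refine tendsto_const_nhds.congr' ?_
        filter_upwards [eventually_ge_atTop M] with N hN
        have : x ∈ A N := by
          rw [div_le_iff₀ (pow_pos (hwpos x) 2)] at hM
          refine hM.trans ?_
          gcongr
        simp [this]
    simpa using this
  have hdiff : ∀ M n, |∫ x, κ x * s n x ∂μ - ∫ x, (A M).indicator κ x * s n x ∂μ| ≤
      ∫ x, |κ x - (A M).indicator κ x| ∂μ := by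
    intro M n
    rw [← integral_sub (hint _ hκ n) (hint _ (hκA M) n)]
    refine (abs_integral_le_integral_abs).trans
      (integral_mono_ae ((hint _ hκ n).sub (hint _ (hκA M) n)).abs (hκ.sub (hκA M)).abs ?_)
    filter_upwards [hs1 n] with x hx
    rw [← sub_mul, abs_mul]
    exact mul_le_of_le_one_right (abs_nonneg _) hx
  rw [Metric.cauchySeq_iff]
  intro ε hε
  obtain ⟨M, hM⟩ := (herr.eventually (gt_mem_nhds (show 0 < ε / 3 by positivity))).exists
  obtain ⟨N, hN⟩ := Metric.cauchySeq_iff.1 (hcau M) (ε / 3) (by positivity)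
  refine ⟨N, fun m hm n hn => ?_⟩
  have h1 := hN m hm n hn
  have h2 := hdiff M (φ m)
  have h3 := hdiff M (φ n)
  rw [Real.dist_eq] at h1 ⊢
  rw [abs_le] at h2 h3
  rw [abs_lt] at h1 ⊢
  constructor <;> linarith

section LpOrder

variable {p : ℝ≥0∞}

theorem Lp.ae_eq_zero_or_eq_of_abs_two_smul_sub_eq {e f₀ : Lp ℝ p μ} (hf₀ : 0 ≤ f₀)
    (he : |(2 : ℝ) • e - f₀| = f₀) : ∀ᵐ x ∂μ, e x = 0 ∨ e x = f₀ x := by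
  have h := Lp.coeFn_abs ((2 : ℝ) • e - f₀)
  rw [he] at h
  filter_upwards [h, Lp.coeFn_sub ((2 : ℝ) • e) f₀, Lp.coeFn_smul (2 : ℝ) e,
    (Lp.coeFn_nonneg _).2 hf₀] with x h1 h2 h3 h4
  rw [h2, Pi.sub_apply, h3, Pi.smul_apply, smul_eq_mul] at h1
  rcases abs_choice (2 * e x - f₀ x) with h | h <;> rw [h] at h1
  · right; linarith
  · left; linarith

theorem Lp.abs_two_smul_sub_eq_of_ae {e f₀ : Lp ℝ p μ} (hf₀ : 0 ≤ f₀)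
    (he : ∀ᵐ x ∂μ, e x = 0 ∨ e x = f₀ x) : |(2 : ℝ) • e - f₀| = f₀ := by
  refine Lp.ext ?_
  filter_upwards [Lp.coeFn_abs ((2 : ℝ) • e - f₀), Lp.coeFn_sub ((2 : ℝ) • e) f₀,
    Lp.coeFn_smul (2 : ℝ) e, (Lp.coeFn_nonneg _).2 hf₀, he] with x h1 h2 h3 h4 h5
  have h4 : 0 ≤ f₀ x := h4
  rw [h1, h2, Pi.sub_apply, h3, Pi.smul_apply, smul_eq_mul]
  rcases h5 with h | h
  · simp [h, abs_of_nonneg h4]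
  · rw [h, two_mul, add_sub_cancel_right, abs_of_nonneg h4]

variable [Fact (1 ≤ p)]

theorem exists_tendsto_Lp_of_ae_tendsto_of_abs_le (hp : p ≠ ∞) (f : ℕ → Lp ℝ p μ)
    (F : Lp ℝ p μ) (hfF : ∀ n, |f n| ≤ F) (G : Ω → ℝ)
    (hG : ∀ᵐ x ∂μ, Tendsto (fun n => f n x) atTop (𝓝 (G x))) :
    ∃ g : Lp ℝ p μ, g =ᵐ[μ] G ∧ Tendsto f atTop (𝓝 g) := by
  have hp0 : p ≠ 0 := (zero_lt_one.trans_le (Fact.out : 1 ≤ p)).ne'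
  have hpr : 0 < p.toReal := ENNReal.toReal_pos hp0 hp
  have hGm : AEStronglyMeasurable G μ :=
    aestronglyMeasurable_of_tendsto_ae _ (fun n => Lp.aestronglyMeasurable (f n)) hG
  have hle : ∀ᵐ x ∂μ, ∀ n, |f n x| ≤ F x := by
    rw [ae_all_iff]
    intro n
    filter_upwards [Lp.coeFn_abs (f n), (Lp.coeFn_le _ _).2 (hfF n)] with x h1 h2
    rwa [← h1]
  have hGF : ∀ᵐ x ∂μ, |G x| ≤ F x := by
    filter_upwards [hle, hG] with x h1 h2
    exact le_of_tendsto h2.abs (.of_forall h1)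
  have hGL : MemLp G p μ := (Lp.memLp F).mono hGm <| by
    filter_upwards [hGF] with x hx
    exact hx.trans (le_abs_self _)
  refine ⟨hGL.toLp G, hGL.coeFn_toLp, ?_⟩
  rw [Lp.tendsto_Lp_iff_tendsto_eLpNorm f G hGL]
  simp_rw [eLpNorm_eq_lintegral_rpow_enorm_toReal hp0 hp]
  have key : Tendsto (fun n => ∫⁻ x, ‖(⇑(f n) - G) x‖ₑ ^ p.toReal ∂μ) atTop
      (𝓝 (∫⁻ _, 0 ∂μ)) := by
    refine tendsto_lintegral_of_dominated_convergence' (fun x => ‖((2 : ℝ) • ⇑F) x‖ₑ ^ p.toReal)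
      (fun n => ?_) (fun n => ?_) ?_ ?_
    · exact (((Lp.aestronglyMeasurable (f n)).sub hGm).enorm).pow_const _
    · filter_upwards [hle, hGF] with x h1 h2
      gcongr
      rw [enorm_le_iff_norm_le, Real.norm_eq_abs, Real.norm_eq_abs]
      refine le_trans ?_ (le_abs_self _)
      simp only [Pi.sub_apply, Pi.smul_apply, smul_eq_mul]
      have := abs_sub (f n x) (G x)
      linarith [h1 n]
    · exact (lintegral_rpow_enorm_lt_top_of_eLpNorm_lt_top hp0 hp
        ((Lp.memLp F).const_smul (2 : ℝ)).2).ne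
    · filter_upwards [hG] with x hx
      have h1 : Tendsto (fun n => ‖f n x - G x‖ₑ) atTop (𝓝 0) := by
        have := (hx.sub_const (G x)).enorm
        simpa using this
      have := h1.ennrpow_const p.toReal
      simpa [ENNReal.zero_rpow_of_pos hpr] using this
  have := key.ennrpow_const (1 / p.toReal)
  simpa [ENNReal.zero_rpow_of_pos (inv_pos.2 hpr)] using this

theorem Lp.norm_sub_rpow_add_norm_rpow_le (hp : p ≠ ∞) {a b : Lp ℝ p μ} (ha : 0 ≤ a)
    (hab : a ≤ b) : ‖b - a‖ ^ p.toReal + ‖a‖ ^ p.toReal ≤ ‖b‖ ^ p.toReal := by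
  have hp1 : 1 ≤ p := Fact.out
  have hp0 : p ≠ 0 := (zero_lt_one.trans_le hp1).ne'
  have hpr : 0 < p.toReal := ENNReal.toReal_pos hp0 hp
  have hpr1 : 1 ≤ p.toReal := by
    rw [← ENNReal.toReal_one]
    exact ENNReal.toReal_mono hp hp1
  have hnorm : ∀ f : Lp ℝ p μ, ENNReal.ofReal (‖f‖ ^ p.toReal) =
      ∫⁻ x, ‖f x‖ₑ ^ p.toReal ∂μ := by
    intro f
    rw [← ENNReal.ofReal_rpow_of_nonneg (norm_nonneg _) hpr.le, ofReal_norm, Lp.enorm_def,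
      eLpNorm_eq_lintegral_rpow_enorm_toReal hp0 hp, ← ENNReal.rpow_mul,
      one_div_mul_cancel hpr.ne', ENNReal.rpow_one]
  rw [← ENNReal.ofReal_le_ofReal_iff (by positivity),
    ENNReal.ofReal_add (by positivity) (by positivity), hnorm, hnorm, hnorm,
    ← lintegral_add_right' _ ((Lp.aestronglyMeasurable a).enorm.pow_const _)]
  refine lintegral_mono_ae ?_
  filter_upwards [Lp.coeFn_sub b a, (Lp.coeFn_nonneg a).2 ha, (Lp.coeFn_le a b).2 hab]
    with x h1 h2 h3
  rw [h1]
  refine (ENNReal.add_rpow_le_rpow_add _ _ hpr1).trans ?_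
  gcongr
  simp only [Pi.sub_apply, Pi.zero_apply] at *
  rw [Real.enorm_of_nonneg (sub_nonneg.2 h3), Real.enorm_of_nonneg h2,
    Real.enorm_of_nonneg (h2.trans h3), ← ENNReal.ofReal_add (sub_nonneg.2 h3) h2,
    sub_add_cancel]

theorem Lp.eq_of_le_of_norm_le (hp : p ≠ ∞) {a b : Lp ℝ p μ} (ha : 0 ≤ a) (hab : a ≤ b)
    (hn : ‖b‖ ≤ ‖a‖) : a = b := by
  have hpr : 0 < p.toReal :=
    ENNReal.toReal_pos (zero_lt_one.trans_le (Fact.out : 1 ≤ p)).ne' hp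
  have h := norm_sub_rpow_add_norm_rpow_le hp ha hab
  have h2 : ‖b‖ ^ p.toReal ≤ ‖a‖ ^ p.toReal := by gcongr
  have h3 : ‖b - a‖ ^ p.toReal = 0 := le_antisymm (by linarith) (by positivity)
  rw [Real.rpow_eq_zero (norm_nonneg _) hpr.ne', norm_eq_zero, sub_eq_zero] at h3
  exact h3.symm

theorem Lp.tendsto_of_le_of_norm_le (hp : p ≠ ∞) {a b : ℕ → Lp ℝ p μ} {l : Lp ℝ p μ}
    (ha : ∀ n, 0 ≤ a n) (hab : ∀ n, a n ≤ b n) (hal : Tendsto a atTop (𝓝 l))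
    (hn : ∀ n, ‖b n‖ ≤ ‖l‖) : Tendsto b atTop (𝓝 l) := by
  have hpr : 0 < p.toReal :=
    ENNReal.toReal_pos (zero_lt_one.trans_le (Fact.out : 1 ≤ p)).ne' hp
  have h1 : Tendsto (fun n => ‖l‖ ^ p.toReal - ‖a n‖ ^ p.toReal) atTop (𝓝 0) := by
    have := (hal.norm.rpow_const (.inr hpr.le) (p := p.toReal)).const_sub (‖l‖ ^ p.toReal)
    simpa using this
  have h2 : Tendsto (fun n => ‖b n - a n‖ ^ p.toReal) atTop (𝓝 0) := by
    refine squeeze_zero (fun n => by positivity) (fun n => ?_) h1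
    have h := norm_sub_rpow_add_norm_rpow_le hp (ha n) (hab n)
    have h2 : ‖b n‖ ^ p.toReal ≤ ‖l‖ ^ p.toReal := by gcongr; exact hn n
    linarith
  have h3 : Tendsto (fun n => ‖b n - a n‖) atTop (𝓝 0) := by
    have := h2.rpow_const (p := p.toReal⁻¹) (.inr (by positivity))
    rw [Real.zero_rpow (by positivity)] at this
    exact this.congr fun n => Real.rpow_rpow_inv (norm_nonneg _) hpr.ne'
  have h4 := (tendsto_zero_iff_norm_tendsto_zero.2 h3).add hal
  simpa using h4

theorem IsPositiveOp.mono {T : Lp ℝ p μ →L[ℝ] Lp ℝ p μ} (hT : IsPositiveOp T)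
    {f g : Lp ℝ p μ} (h : f ≤ g) : T f ≤ T g := by
  have := hT (g - f) (sub_nonneg.2 h)
  rwa [map_sub, sub_nonneg] at this

theorem IsPositiveOp.abs_le {T : Lp ℝ p μ →L[ℝ] Lp ℝ p μ} (hT : IsPositiveOp T)
    (f : Lp ℝ p μ) : |T f| ≤ T |f| := by
  refine abs_le'.2 ⟨hT.mono (le_abs_self f), ?_⟩
  rw [← map_neg]
  exact hT.mono (neg_le_abs f)

theorem IsPositiveOp.abs_le_of_abs_le {T : Lp ℝ p μ →L[ℝ] Lp ℝ p μ} (hT : IsPositiveOp T)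
    {f F : Lp ℝ p μ} (h : |f| ≤ F) (hF : T F = F) : |T f| ≤ F :=
  (hT.abs_le f).trans ((hT.mono h).trans_eq hF)

theorem IsIntegralOp.exists_subseq_tendsto [SigmaFinite μ] (hp : p ≠ ∞)
    {T : Lp ℝ p μ →L[ℝ] Lp ℝ p μ} (hT : IsIntegralOp T) (hpos : IsPositiveOp T)
    (F : Lp ℝ p μ) (f : ℕ → Lp ℝ p μ) (hf : ∀ n, |f n| ≤ F) :
    ∃ φ : ℕ → ℕ, StrictMono φ ∧ ∃ g, Tendsto (fun n => T (f (φ n))) atTop (𝓝 g) := by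
  obtain ⟨k, -, -, hk⟩ := hT
  have hle : ∀ n, ∀ᵐ x ∂μ, |f n x| ≤ F x := fun n => by
    filter_upwards [Lp.coeFn_abs (f n), (Lp.coeFn_le _ _).2 (hf n)] with x h1 h2
    rwa [← h1]
  obtain ⟨φ, hφ, hc⟩ := exists_subseq_forall_cauchySeq_integral_mul (μ := μ)
    (fun n x => f n x / F x)
    (fun n => ((Lp.aestronglyMeasurable (f n)).aemeasurable.div
      (Lp.aestronglyMeasurable F).aemeasurable).aestronglyMeasurable)
    (fun n => by
      filter_upwards [hle n] with x hx
      rw [abs_div]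
      exact div_le_one_of_le₀ (hx.trans (le_abs_self _)) (abs_nonneg _))
  have hlim : ∀ᵐ y ∂μ, ∃ l, Tendsto (fun n => T (f (φ n)) y) atTop (𝓝 l) := by
    filter_upwards [(hk F).1, ae_all_iff.2 fun n => (hk (f n)).2] with y h1 h2
    obtain ⟨l, hl⟩ := cauchySeq_tendsto_of_complete (hc _ h1)
    refine ⟨l, hl.congr fun n => ?_⟩
    rw [h2]
    refine integral_congr_ae ?_
    filter_upwards [hle (φ n)] with x hx
    by_cases h0 : F x = 0
    · have : f (φ n) x = 0 := by simpa [h0] using hx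
      simp [this]
    · field_simp
  obtain ⟨g, -, hg⟩ := exists_tendsto_Lp_of_ae_tendsto_of_abs_le hp (fun n => T (f (φ n))) (T F)
    (fun n => (hpos.abs_le _).trans (hpos.mono (hf _)))
    (fun y => limUnder atTop fun n => T (f (φ n)) y)
    (hlim.mono fun y hy => tendsto_nhds_limUnder hy)
  exact ⟨φ, hφ, g, hg⟩

theorem Lp.exists_tendsto_smul_posPart_inf (hp : p ≠ ∞) {f₀ : Lp ℝ p μ} (hf₀ : 0 ≤ f₀)
    (h : Lp ℝ p μ) : ∃ e : Lp ℝ p μ,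
      Tendsto (fun n : ℕ => ((n : ℝ) • (h ⊔ 0)) ⊓ f₀) atTop (𝓝 e) ∧
      ∀ᵐ x ∂μ, e x = if 0 < h x then f₀ x else 0 := by
  have hev : ∀ᵐ x ∂μ, ∀ n : ℕ,
      (((n : ℝ) • (h ⊔ 0)) ⊓ f₀ : Lp ℝ p μ) x = min (n * max (h x) 0) (f₀ x) := by
    rw [ae_all_iff]
    intro n
    filter_upwards [Lp.coeFn_inf ((n : ℝ) • (h ⊔ 0)) f₀, Lp.coeFn_smul (n : ℝ) (h ⊔ 0),
      Lp.coeFn_sup h 0, Lp.coeFn_zero ℝ p μ] with x h1 h2 h3 h4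
    rw [h1, Pi.inf_apply, h2, Pi.smul_apply, h3, Pi.sup_apply, h4]
    rfl
  have hbd : ∀ n : ℕ, |((n : ℝ) • (h ⊔ 0)) ⊓ f₀| ≤ f₀ := by
    intro n
    rw [← Lp.coeFn_le]
    filter_upwards [Lp.coeFn_abs (((n : ℝ) • (h ⊔ 0)) ⊓ f₀), hev, (Lp.coeFn_nonneg _).2 hf₀]
      with x h1 h2 h3
    rw [h1, h2, abs_of_nonneg (le_min (by positivity) h3)]
    exact min_le_right _ _
  have hae : ∀ᵐ x ∂μ, Tendsto (fun n : ℕ => (((n : ℝ) • (h ⊔ 0)) ⊓ f₀ : Lp ℝ p μ) x) atTop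
      (𝓝 (if 0 < h x then f₀ x else 0)) := by
    filter_upwards [hev, (Lp.coeFn_nonneg _).2 hf₀] with x h2 h3
    simp_rw [h2]
    split_ifs with hx
    · refine tendsto_const_nhds.congr' ?_
      obtain ⟨N, hN⟩ := exists_nat_ge (f₀ x / h x)
      filter_upwards [eventually_ge_atTop N] with n hn
      rw [max_eq_left hx.le, min_eq_right]
      rw [div_le_iff₀ hx] at hN
      refine hN.trans ?_
      gcongr
    · rw [max_eq_right (not_lt.1 hx)]
      have h3 : 0 ≤ f₀ x := h3
      simp [h3]
  obtain ⟨e, he, hlim⟩ := exists_tendsto_Lp_of_ae_tendsto_of_abs_le hp _ f₀ hbd _ hae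
  exact ⟨e, hlim, he⟩

/-- A lattice homomorphism on a closed sublattice `F` which fixes every component of the weak
unit `f₀` is the identity on `F`. -/
theorem Lp.apply_eq_self_of_forall_component (hp : p ≠ ∞) {f₀ : Lp ℝ p μ}
    (hf₀ : ∀ᵐ x ∂μ, 0 < f₀ x) {F : Submodule ℝ (Lp ℝ p μ)} (hFc : IsClosed (F : Set (Lp ℝ p μ)))
    (hFabs : ∀ g ∈ F, |g| ∈ F) (hf₀F : f₀ ∈ F) {V : Lp ℝ p μ →L[ℝ] Lp ℝ p μ}
    (hVabs : ∀ g ∈ F, V |g| = |V g|) (hVf₀ : V f₀ = f₀)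
    (hV : ∀ e ∈ F, |(2 : ℝ) • e - f₀| = f₀ → V e = e) : ∀ g ∈ F, V g = g := by
  have hf₀' : 0 ≤ f₀ := (Lp.coeFn_nonneg _).1 (hf₀.mono fun x hx => hx.le)
  have hFsup : ∀ a ∈ F, ∀ b ∈ F, a ⊔ b ∈ F ∧ V (a ⊔ b) = V a ⊔ V b := by
    intro a ha b hb
    have hd := F.sub_mem hb ha
    rw [sup_eq_half_smul_add_add_abs_sub ℝ a b, sup_eq_half_smul_add_add_abs_sub ℝ (V a)]
    refine ⟨F.smul_mem _ (F.add_mem (F.add_mem ha hb) (hFabs _ hd)), ?_⟩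
    rw [map_smul, map_add, map_add, hVabs _ hd, map_sub]
  have hFinf : ∀ a ∈ F, ∀ b ∈ F, a ⊓ b ∈ F ∧ V (a ⊓ b) = V a ⊓ V b := by
    intro a ha b hb
    have hd := F.sub_mem hb ha
    rw [inf_eq_half_smul_add_sub_abs_sub ℝ a b, inf_eq_half_smul_add_sub_abs_sub ℝ (V a)]
    refine ⟨F.smul_mem _ (F.sub_mem (F.add_mem ha hb) (hFabs _ hd)), ?_⟩
    rw [map_smul, map_sub, map_add, hVabs _ hd, map_sub]
  intro g hg
  have key : ∀ c : ℚ, ∀ᵐ x ∂μ, (c * f₀ x < g x ↔ c * f₀ x < V g x) := by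
    intro c
    set h := g - (c : ℝ) • f₀ with hh
    have hhF : h ∈ F := F.sub_mem hg (F.smul_mem _ hf₀F)
    have hVh : V h = V g - (c : ℝ) • f₀ := by rw [hh, map_sub, map_smul, hVf₀]
    obtain ⟨e, he, hex⟩ := exists_tendsto_smul_posPart_inf hp hf₀' h
    obtain ⟨e', he', hex'⟩ := exists_tendsto_smul_posPart_inf hp hf₀' (V h)
    have hsup := hFsup h hhF 0 F.zero_mem
    have hmem := fun n : ℕ => hFinf _ (F.smul_mem (n : ℝ) hsup.1) f₀ hf₀F
    have heF : e ∈ F := hFc.mem_of_tendsto he (.of_forall fun n => (hmem n).1)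
    have hVe : V e = e' := by
      refine tendsto_nhds_unique ((V.continuous.tendsto e).comp he) (he'.congr fun n => ?_)
      rw [Function.comp_apply, (hmem n).2, map_smul, hsup.2, map_zero, hVf₀]
    have hee' : e' = e := by
      rw [← hVe]
      refine hV e heF (abs_two_smul_sub_eq_of_ae hf₀' ?_)
      filter_upwards [hex] with x hx
      rw [hx]
      split_ifs <;> simp
    rw [hee', hVh] at hex'
    rw [hh] at hex
    filter_upwards [hex, hex', hf₀, Lp.coeFn_sub g ((c : ℝ) • f₀),
      Lp.coeFn_sub (V g) ((c : ℝ) • f₀), Lp.coeFn_smul (c : ℝ) f₀] with x h1 h2 h3 h4 h5 h6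
    simp only [h1, h4, h5, Pi.sub_apply, h6, Pi.smul_apply, smul_eq_mul, sub_pos] at h2
    split_ifs at h2 <;> first | tauto | exact absurd h2 (by linarith)
  refine Lp.ext ?_
  filter_upwards [ae_all_iff.2 key, hf₀] with x hx h0
  have hx' : ∀ c : ℚ, (c : ℝ) < g x / f₀ x ↔ (c : ℝ) < V g x / f₀ x := fun c => by
    rw [lt_div_iff₀ h0, lt_div_iff₀ h0, hx]
  have : V g x / f₀ x = g x / f₀ x :=
    le_antisymm (le_of_forall_rat_lt_imp_le fun c hc => ((hx' c).2 hc).le)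
      (le_of_forall_rat_lt_imp_le fun c hc => ((hx' c).1 hc).le)
  exact (div_left_inj' h0.ne').1 this

/-- In the Boolean algebra of components of `f₀`, a lattice homomorphism `V` satisfies
`(V - 1)² = V² - 1`, just as in characteristic two. -/
theorem Lp.exists_component_apply_sub_eq {f₀ : Lp ℝ p μ} (hf₀ : 0 ≤ f₀)
    {F : Submodule ℝ (Lp ℝ p μ)} (hFabs : ∀ g ∈ F, |g| ∈ F) (hf₀F : f₀ ∈ F)
    {V : Lp ℝ p μ →L[ℝ] Lp ℝ p μ} (hVF : ∀ g ∈ F, V g ∈ F)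
    (hVabs : ∀ g ∈ F, V |g| = |V g|) (hVf₀ : V f₀ = f₀) {e : Lp ℝ p μ} (he : e ∈ F)
    (hec : |(2 : ℝ) • e - f₀| = f₀) :
    ∃ e' ∈ F, |(2 : ℝ) • e' - f₀| = f₀ ∧ ‖V e' - e'‖ = ‖V (V e) - e‖ := by
  have hcomp : ∀ a ∈ F, |(2 : ℝ) • a - f₀| = f₀ → |(2 : ℝ) • V a - f₀| = f₀ := by
    intro a ha hac
    have := hVabs _ (F.sub_mem (F.smul_mem (2 : ℝ) ha) hf₀F)
    rw [hac, map_sub, map_smul, hVf₀] at this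
    exact this.symm
  have hVe := hVF e he
  have hd := F.sub_mem he hVe
  have h0 := ae_eq_zero_or_eq_of_abs_two_smul_sub_eq hf₀ hec
  have h1 := ae_eq_zero_or_eq_of_abs_two_smul_sub_eq hf₀ (hcomp e he hec)
  have h2 := ae_eq_zero_or_eq_of_abs_two_smul_sub_eq hf₀ (hcomp _ hVe (hcomp e he hec))
  have hf₀x := (Lp.coeFn_nonneg _).2 hf₀
  refine ⟨|e - V e|, hFabs _ hd, abs_two_smul_sub_eq_of_ae hf₀ ?_, ?_⟩
  · filter_upwards [h0, h1, hf₀x, Lp.coeFn_abs (e - V e), Lp.coeFn_sub e (V e)]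
      with x h0 h1 hx h3 h4
    have hx : 0 ≤ f₀ x := hx
    rw [h3, h4, Pi.sub_apply]
    rcases h0 with h0 | h0 <;> rcases h1 with h1 | h1 <;> simp [h0, h1, abs_of_nonneg hx]
  · rw [hVabs _ hd, map_sub, ← norm_abs_eq_norm, ← norm_abs_eq_norm (V (V e) - e)]
    congr 1
    refine Lp.ext ?_
    filter_upwards [h0, h1, h2, hf₀x, Lp.coeFn_abs (e - V e), Lp.coeFn_sub e (V e),
      Lp.coeFn_abs (V e - V (V e)), Lp.coeFn_sub (V e) (V (V e)),
      Lp.coeFn_abs (V (V e) - e), Lp.coeFn_sub (V (V e)) e,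
      Lp.coeFn_abs (|V e - V (V e)| - |e - V e|), Lp.coeFn_sub (|V e - V (V e)|) (|e - V e|)]
      with x h0 h1 h2 hx h3 h4 h5 h6 h7 h8 h9 h10
    have hx : 0 ≤ f₀ x := hx
    rw [h9, h10, Pi.sub_apply, h5, h3, h7, h4, h6, h8]
    simp only [Pi.sub_apply]
    rcases h0 with h0 | h0 <;> rcases h1 with h1 | h1 <;> rcases h2 with h2 | h2 <;>
      simp [h0, h1, h2, abs_of_nonneg hx]

theorem Lp.exists_tendsto_smul_of_ae_pos (hp : p ≠ ∞) {f₀ : Lp ℝ p μ}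
    (hf₀ : ∀ᵐ x ∂μ, 0 < f₀ x) (f : Lp ℝ p μ) :
    ∃ u : ℕ → Lp ℝ p μ, (∀ n, |u n| ≤ f₀) ∧
      Tendsto (fun n : ℕ => (n : ℝ) • u n) atTop (𝓝 f) := by
  have hf₀' : 0 ≤ f₀ := (Lp.coeFn_nonneg _).1 (hf₀.mono fun x hx => hx.le)
  have hev : ∀ n : ℕ, ∀ᵐ x ∂μ, ((((n : ℝ)⁻¹ • f) ⊓ f₀) ⊔ (-f₀) : Lp ℝ p μ) x =
      max (min ((n : ℝ)⁻¹ * f x) (f₀ x)) (-f₀ x) := by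
    intro n
    filter_upwards [Lp.coeFn_sup (((n : ℝ)⁻¹ • f) ⊓ f₀) (-f₀), Lp.coeFn_neg f₀,
      Lp.coeFn_inf ((n : ℝ)⁻¹ • f) f₀, Lp.coeFn_smul (n : ℝ)⁻¹ f] with x h1 h2 h3 h4
    rw [h1, Pi.sup_apply, h2, h3, Pi.inf_apply, h4, Pi.smul_apply, Pi.neg_apply]
    rfl
  set u : ℕ → Lp ℝ p μ := fun n => (((n : ℝ)⁻¹ • f) ⊓ f₀) ⊔ (-f₀) with hu
  have hev' : ∀ n : ℕ, ∀ᵐ x ∂μ, ((n : ℝ) • u n : Lp ℝ p μ) x =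
      n * max (min ((n : ℝ)⁻¹ * f x) (f₀ x)) (-f₀ x) := by
    intro n
    filter_upwards [hev n, Lp.coeFn_smul (n : ℝ) (u n)] with x h1 h2
    rw [h2, Pi.smul_apply, h1, smul_eq_mul]
  have hbd : ∀ n : ℕ, |(n : ℝ) • u n| ≤ |f| := by
    intro n
    rw [← Lp.coeFn_le]
    filter_upwards [hev' n, Lp.coeFn_abs ((n : ℝ) • u n), Lp.coeFn_abs f, hf₀] with x h1 h2 h3 h4
    rw [h2, h3, h1]
    rcases n.eq_zero_or_pos with rfl | hn
    · simp
    have hn : (0 : ℝ) < n := by exact_mod_cast hn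
    rw [abs_mul, abs_of_pos hn, ← le_div_iff₀' hn]
    have h5 : |(n : ℝ)⁻¹ * f x| = |f x| / n := by
      rw [abs_mul, abs_inv, abs_of_pos hn]; field_simp
    rw [← h5]
    have := neg_abs_le ((n : ℝ)⁻¹ * f x)
    have := le_abs_self ((n : ℝ)⁻¹ * f x)
    have := abs_nonneg ((n : ℝ)⁻¹ * f x)
    rw [abs_le]
    constructor
    · rcases le_total ((n : ℝ)⁻¹ * f x) (f₀ x) with h | h
      · rw [min_eq_left h]; exact le_max_of_le_left (by linarith)
      · rw [min_eq_right h]; exact le_max_of_le_left (by linarith)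
    · exact max_le ((min_le_left _ _).trans (by linarith)) (by linarith)
  have hae : ∀ᵐ x ∂μ, Tendsto (fun n : ℕ => ((n : ℝ) • u n : Lp ℝ p μ) x) atTop (𝓝 (f x)) := by
    filter_upwards [ae_all_iff.2 hev', hf₀] with x h1 h2
    refine tendsto_const_nhds.congr' ?_
    obtain ⟨N, hN⟩ := exists_nat_ge (|f x| / f₀ x)
    filter_upwards [eventually_ge_atTop N, eventually_gt_atTop 0] with n hn hn0
    have hn0 : (0 : ℝ) < n := by exact_mod_cast hn0
    have h3 : |(n : ℝ)⁻¹ * f x| ≤ f₀ x := by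
      rw [div_le_iff₀ h2] at hN
      rw [abs_mul, abs_inv, abs_of_pos hn0, inv_mul_le_iff₀ hn0]
      refine hN.trans ?_
      gcongr
    rw [_root_.abs_le] at h3
    rw [h1, min_eq_left h3.2, max_eq_left h3.1, mul_inv_cancel_left₀ hn0.ne']
  obtain ⟨g, hg, hlim⟩ := exists_tendsto_Lp_of_ae_tendsto_of_abs_le hp _ |f| hbd _ hae
  refine ⟨u, fun n => ?_, ?_⟩
  · refine abs_le'.2 ⟨sup_le inf_le_right ((neg_nonpos.2 hf₀').trans hf₀'), ?_⟩
    rw [neg_le]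
    exact le_sup_right
  · rwa [Lp.ext hg] at hlim

/-- The vectors `g` that are recurrent along `U`, that is `U n g → g`. -/
def recurrentSubmodule (U : ℕ → Lp ℝ p μ →L[ℝ] Lp ℝ p μ) : Submodule ℝ (Lp ℝ p μ) where
  carrier := {g | Tendsto (fun n => U n g) atTop (𝓝 g)}
  add_mem' {a b} ha hb := by
    simp only [Set.mem_ofPred_eq, map_add] at *
    exact ha.add hb
  zero_mem' := by simp
  smul_mem' c a ha := by
    simp only [Set.mem_ofPred_eq, map_smul] at *
    exact ha.const_smul c

theorem mem_recurrentSubmodule {U : ℕ → Lp ℝ p μ →L[ℝ] Lp ℝ p μ} {g : Lp ℝ p μ} :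
    g ∈ recurrentSubmodule U ↔ Tendsto (fun n => U n g) atTop (𝓝 g) := Iff.rfl

theorem isClosed_recurrentSubmodule {U : ℕ → Lp ℝ p μ →L[ℝ] Lp ℝ p μ}
    (hU : ∀ n f, ‖U n f‖ ≤ ‖f‖) : IsClosed (recurrentSubmodule U : Set (Lp ℝ p μ)) := by
  rw [← closure_subset_iff_isClosed]
  intro g hg
  rw [SetLike.mem_coe, mem_recurrentSubmodule, Metric.tendsto_atTop]
  intro ε hε
  obtain ⟨h, hh, hgh⟩ := Metric.mem_closure_iff.1 hg (ε / 3) (by positivity)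
  obtain ⟨N, hN⟩ := Metric.tendsto_atTop.1 (mem_recurrentSubmodule.1 hh) (ε / 3) (by positivity)
  refine ⟨N, fun n hn => ?_⟩
  have h1 : dist (U n g) (U n h) ≤ dist g h := by
    rw [dist_eq_norm, dist_eq_norm, ← map_sub]
    exact hU n _
  have h2 := dist_triangle4 (U n g) (U n h) h g
  have h3 := hN n hn
  rw [dist_comm h g] at h2
  linarith

theorem abs_mem_recurrentSubmodule (hp : p ≠ ∞) {U : ℕ → Lp ℝ p μ →L[ℝ] Lp ℝ p μ}
    (hpos : ∀ n, IsPositiveOp (U n)) (hU : ∀ n f, ‖U n f‖ ≤ ‖f‖) {g : Lp ℝ p μ}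
    (hg : g ∈ recurrentSubmodule U) : |g| ∈ recurrentSubmodule U :=
  Lp.tendsto_of_le_of_norm_le hp (fun _ => abs_nonneg _) (fun n => (hpos n).abs_le g)
    ((mem_recurrentSubmodule.1 hg).sup_nhds (mem_recurrentSubmodule.1 hg).neg) fun n => hU n _

/-- Along a sequence of times tending to infinity, every recurrent vector is a fixed point. -/
theorem apply_eq_self_of_mem_recurrentSubmodule [SigmaFinite μ] (hp : p ≠ ∞)
    {T : ℝ≥0 → (Lp ℝ p μ →L[ℝ] Lp ℝ p μ)} (hpos : ∀ t, IsPositiveOp (T t))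
    (hcontr : ∀ t (f : Lp ℝ p μ), ‖T t f‖ ≤ ‖f‖)
    (hT0 : T 0 = ContinuousLinearMap.id ℝ (Lp ℝ p μ))
    (hsem : ∀ s t, T (s + t) = (T s).comp (T t))
    (hcont : ∀ f : Lp ℝ p μ, Continuous fun t => T t f)
    {f₀ : Lp ℝ p μ} (hfix : ∀ t, T t f₀ = f₀) (hf₀pos : ∀ᵐ x ∂μ, 0 < f₀ x)
    {t₀ : ℝ≥0} (hker : IsIntegralOp (T t₀)) {t : ℕ → ℝ≥0} (ht : Tendsto t atTop atTop)
    {g : Lp ℝ p μ} (hg : g ∈ recurrentSubmodule fun n => T (t n)) (s : ℝ≥0) : T s g = g := by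
  have hf₀ : 0 ≤ f₀ := (Lp.coeFn_nonneg _).1 (hf₀pos.mono fun x hx => hx.le)
  set F := recurrentSubmodule fun n => T (t n) with hF
  have hadd : ∀ a b f, T (a + b) f = T a (T b f) := fun a b f => by rw [hsem]; rfl
  have hcomm : ∀ a b f, T a (T b f) = T b (T a f) := fun a b f => by
    rw [← hadd, add_comm, hadd]
  have hFc : IsClosed (F : Set (Lp ℝ p μ)) := isClosed_recurrentSubmodule fun n => hcontr _
  have hFabs : ∀ g ∈ F, |g| ∈ F := fun g hg =>
    abs_mem_recurrentSubmodule hp (fun n => hpos _) (fun n => hcontr _) hg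
  have hf₀F : f₀ ∈ F := by
    rw [hF, mem_recurrentSubmodule]
    simp [hfix]
  have hTF : ∀ s, ∀ g ∈ F, T s g ∈ F := fun s g hg => by
    rw [hF, mem_recurrentSubmodule]
    simp_rw [hcomm _ s]
    exact ((T s).continuous.tendsto g).comp hg
  have hiso : ∀ s, ∀ g ∈ F, ‖g‖ ≤ ‖T s g‖ := fun s g hg => by
    refine le_of_tendsto (mem_recurrentSubmodule.1 hg).norm ?_
    filter_upwards [ht.eventually_ge_atTop s] with n hn
    rw [← tsub_add_cancel_of_le hn, hadd]
    exact hcontr _ _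
  have hTabs : ∀ s, ∀ g ∈ F, T s |g| = |T s g| := fun s g hg => by
    refine (Lp.eq_of_le_of_norm_le hp (abs_nonneg _) ((hpos s).abs_le g) ?_).symm
    rw [norm_abs_eq_norm]
    refine (hcontr s _).trans ?_
    rw [norm_abs_eq_norm]
    exact hiso s g hg
  refine Lp.apply_eq_self_of_forall_component hp hf₀pos hFc hFabs hf₀F (hTabs s) (hfix s)
    (fun e he hec => ?_) g hg
  have hhalf : ∀ n : ℕ, ∃ e' ∈ F, |(2 : ℝ) • e' - f₀| = f₀ ∧
      ‖T (s / 2 ^ n) e' - e'‖ = ‖T s e - e‖ := by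
    intro n
    induction n with
    | zero => exact ⟨e, he, hec, by simp⟩
    | succ n ih =>
      obtain ⟨a, ha, hac, hae⟩ := ih
      obtain ⟨b, hb, hbc, hbe⟩ := Lp.exists_component_apply_sub_eq hf₀ hFabs hf₀F
        (hTF (s / 2 ^ (n + 1))) (hTabs _) (hfix _) ha hac
      refine ⟨b, hb, hbc, ?_⟩
      rw [hbe, ← hae, ← hadd, pow_succ, ← div_div, add_halves]
  choose a ha hac hae using hhalf
  have happrox : ∀ n : ℕ, ∃ d : Lp ℝ p μ, |d| ≤ f₀ ∧ ‖T t₀ d - a n‖ < 1 / (n + 1) := by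
    intro n
    have h1 : ∀ᶠ k in atTop, ‖T (t k) (a n) - a n‖ < 1 / ((n : ℝ) + 1) := by
      have h := Metric.tendsto_nhds.1 (mem_recurrentSubmodule.1 (ha n)) (1 / ((n : ℝ) + 1))
        (by positivity)
      simpa only [dist_eq_norm] using h
    obtain ⟨k, hk, hk'⟩ := (h1.and (ht.eventually_ge_atTop t₀)).exists
    refine ⟨T (t k - t₀) (a n), (hpos _).abs_le_of_abs_le ?_ (hfix _), ?_⟩
    · rw [← Lp.coeFn_le]
      filter_upwards [Lp.ae_eq_zero_or_eq_of_abs_two_smul_sub_eq hf₀ (hac n), hf₀pos,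
        Lp.coeFn_abs (a n)] with x h1 h2 h3
      rw [h3]
      rcases h1 with h1 | h1 <;> simp [h1, h2.le, abs_of_pos h2]
    · rwa [← hadd, add_tsub_cancel_of_le hk']
  choose d hd hda using happrox
  obtain ⟨φ, hφ, l, hl⟩ := hker.exists_subseq_tendsto hp (hpos t₀) f₀ d hd
  have hsmall : Tendsto (fun n => T t₀ (d (φ n)) - a (φ n)) atTop (𝓝 0) :=
    squeeze_zero_norm (fun n => (hda (φ n)).le)
      (tendsto_one_div_add_atTop_nhds_zero_nat.comp hφ.tendsto_atTop)
  have hal : Tendsto (fun n => a (φ n)) atTop (𝓝 l) := by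
    simpa using hl.sub hsmall
  have hs0 : Tendsto (fun n => s / 2 ^ φ n) atTop (𝓝 0) := by
    have h : Tendsto (fun n : ℕ => s * (1 / 2 : ℝ≥0) ^ n) atTop (𝓝 (s * 0)) :=
      (NNReal.tendsto_pow_atTop_nhds_zero_of_lt_one (by norm_num)).const_mul s
    rw [mul_zero] at h
    refine (h.comp hφ.tendsto_atTop).congr fun n => ?_
    rw [Function.comp_apply, one_div, inv_pow, div_eq_mul_inv]
  have hTl : Tendsto (fun n => T (s / 2 ^ φ n) l) atTop (𝓝 l) := by
    have h := ((hcont l).tendsto 0).comp hs0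
    rwa [hT0] at h
  have hTal : Tendsto (fun n => T (s / 2 ^ φ n) (a (φ n) - l)) atTop (𝓝 0) := by
    refine squeeze_zero_norm (fun n => hcontr _ _) ?_
    simpa using (hal.sub_const l).norm
  have hzero : Tendsto (fun n => ‖T (s / 2 ^ φ n) (a (φ n)) - a (φ n)‖) atTop (𝓝 0) := by
    have h := ((hTal.add hTl).sub hal).norm
    simpa using h
  simp_rw [hae] at hzero
  have := tendsto_nhds_unique tendsto_const_nhds hzero
  rwa [norm_eq_zero, sub_eq_zero] at this

end LpOrder

end LpLemmas

/-- **Greiner's theorem.** A positive contractive `C₀`-semigroup on `L^p` over a σ-finite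
measure space containing an integral operator and having an a.e. strictly positive fixed
point converges strongly as `t → ∞`, and the limit is a fixed point of the semigroup. -/
theorem greiner_convergence
    {Ω : Type*} [MeasurableSpace Ω] (μ : Measure Ω) [SigmaFinite μ]
    (p : ℝ≥0∞) [Fact (1 ≤ p)] (hp : p ≠ ∞)
    (T : ℝ≥0 → (Lp ℝ p μ →L[ℝ] Lp ℝ p μ))
    (hpos : ∀ t, IsPositiveOp (T t))
    (hcontr : ∀ t (f : Lp ℝ p μ), ‖T t f‖ ≤ ‖f‖)
    (hT0 : T 0 = ContinuousLinearMap.id ℝ (Lp ℝ p μ))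
    (hsem : ∀ s t, T (s + t) = (T s).comp (T t))
    (hcont : ∀ f : Lp ℝ p μ, Continuous fun t => T t f)
    (f₀ : Lp ℝ p μ) (hfix : ∀ t, T t f₀ = f₀)
    (hf₀pos : ∀ᵐ x ∂μ, 0 < f₀ x)
    (t₀ : ℝ≥0) (hker : IsIntegralOp (T t₀)) :
    ∀ f : Lp ℝ p μ, ∃ g : Lp ℝ p μ,
      Tendsto (fun t => T t f) atTop (nhds g) ∧ ∀ s, T s g = g := by
  have hadd : ∀ a b f, T (a + b) f = T a (T b f) := fun a b f => by rw [hsem]; rfl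
  have hlim_of_mem : ∀ f : Lp ℝ p μ, |f| ≤ f₀ →
      ∃ g, Tendsto (fun t => T t f) atTop (nhds g) := by
    intro f hf
    obtain ⟨φ, hφ, g, hg⟩ := hker.exists_subseq_tendsto hp (hpos t₀) f₀
      (fun n : ℕ => T n f) (fun n => (hpos _).abs_le_of_abs_le hf (hfix _))
    set t : ℕ → ℝ≥0 := fun n => ((φ (2 * n) - φ n : ℕ) : ℝ≥0) with ht
    have hφle : ∀ n, φ n + n ≤ φ (2 * n) := fun n => by
      rw [two_mul, add_comm]
      exact hφ.add_le_nat n n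
    have httop : Tendsto t atTop atTop := by
      refine tendsto_atTop_mono (fun n => ?_) tendsto_natCast_atTop_atTop
      rw [ht, Nat.cast_le]
      have := hφle n
      omega
    have hrec : g ∈ recurrentSubmodule fun n => T (t n) := by
      have h1 : Tendsto (fun n => T (t n) (T t₀ (T (φ n) f))) atTop (nhds g) := by
        refine (hg.comp (tendsto_id.const_mul_atTop' two_pos)).congr fun n => ?_
        have hsum : t n + t₀ + φ n = t₀ + φ (2 * n) := by
          rw [ht, add_right_comm, ← Nat.cast_add,
            Nat.sub_add_cancel ((Nat.le_add_right _ _).trans (hφle n)), add_comm]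
        rw [Function.comp_apply, id, ← hadd, ← hadd, ← hadd, hsum]
      have h2 : Tendsto (fun n => T (t n) (g - T t₀ (T (φ n) f))) atTop (nhds 0) := by
        refine squeeze_zero_norm (fun n => hcontr _ _) ?_
        simpa using (hg.const_sub g).norm
      rw [mem_recurrentSubmodule]
      simpa using h2.add h1
    have hgfix := apply_eq_self_of_mem_recurrentSubmodule hp hpos hcontr hT0 hsem hcont hfix
      hf₀pos hker httop hrec
    refine ⟨g, Metric.tendsto_atTop.2 fun ε hε => ?_⟩
    obtain ⟨N, hN⟩ := Metric.tendsto_atTop.1 hg ε hε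
    refine ⟨t₀ + φ N, fun r hr => ?_⟩
    rw [← tsub_add_cancel_of_le hr, hadd, hadd t₀, dist_eq_norm]
    nth_rw 1 [← hgfix (r - (t₀ + φ N))]
    rw [← map_sub]
    refine (hcontr _ _).trans_lt ?_
    rw [← dist_eq_norm]
    exact hN N le_rfl
  intro f
  have hcauchy : CauchySeq fun t => T t f := by
    obtain ⟨u, hu, hlim⟩ := Lp.exists_tendsto_smul_of_ae_pos hp hf₀pos f
    rw [Metric.cauchySeq_iff]
    intro ε hε
    obtain ⟨n, hn⟩ := (Metric.tendsto_nhds.1 hlim (ε / 3) (by positivity)).exists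
    obtain ⟨g, hg⟩ := hlim_of_mem (u n) (hu n)
    obtain ⟨N, hN⟩ := Metric.cauchySeq_iff.1 (hg.const_smul (n : ℝ)).cauchySeq (ε / 3)
      (by positivity)
    refine ⟨N, fun r hr r' hr' => ?_⟩
    have h1 : ∀ r, dist (T r f) ((n : ℝ) • T r (u n)) ≤ dist ((n : ℝ) • u n) f := fun r => by
      rw [← map_smul, dist_eq_norm, ← map_sub, dist_comm, dist_eq_norm]
      exact hcontr _ _
    have h2 := hN r hr r' hr'
    have h3 := dist_triangle4_right (T r f) (T r' f) ((n : ℝ) • T r (u n)) ((n : ℝ) • T r' (u n))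
    linarith [h1 r, h1 r']
  obtain ⟨g, hg⟩ := cauchySeq_tendsto_of_complete hcauchy
  refine ⟨g, hg, fun s => ?_⟩
  refine tendsto_nhds_unique (((T s).continuous.tendsto g).comp hg) ?_
  exact (hg.comp (tendsto_atTop_mono (fun r => le_add_self) tendsto_id)).congr
    fun r => hadd s r f
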